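/- arXiv:1706.02350 — 2 statements merged into one kernel-verified Lean document; each statement's English description precedes it below -/
import Mathlib

section
/- Let m ≥ 1 and k be integers with k ≥ C(m+1,3), and set d = 3k. Then ⌊(C(d+3,3) − m(m+1)(3d+5−2m)/6)/(d+1)⌋ = (3k² + 5k + 2)/2 − C(m+1,2), and the corresponding remainder C(d+3,3) − m(m+1)(3d+5−2m)/6 − (d+1)·⌊(C(d+3,3) − m(m+1)(3d+5−2m)/6)/(d+1)⌋ equals 2·C(m+1,3). -/
theorem Nat.cast_succ_choose_three (n : ℕ) :
    ((n + 1).choose 3 : ℚ) = ((n : ℚ) + 1) * n * (n - 1) / 6 := by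
  induction n with
  | zero => simp [Nat.choose_eq_zero_of_lt]
  | succ n ih =>
    rw [Nat.choose_succ_succ' (n + 1) 2, Nat.cast_add, ih, Nat.cast_choose_two]
    push_cast
    ring

theorem exists_nat_cast_eq_quadratic_div_two (k : ℕ) :
    ∃ q : ℕ, (q : ℚ) = (3 * (k : ℚ) ^ 2 + 5 * (k : ℚ) + 2) / 2 := by
  induction k with
  | zero => exact ⟨1, by norm_num⟩
  | succ k ih =>
    obtain ⟨q, hq⟩ := ih
    refine ⟨q + 3 * k + 4, ?_⟩
    push_cast
    rw [hq]
    ring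

/-- For integers `m ≥ 1` and `k ≥ C(m+1,3)`, with `d = 3k` and
`c(d,m) = m(m+1)(3d+5−2m)/6`, the quotient `r(d,m) = ⌊(C(d+3,3) − c(d,m))/(d+1)⌋`
equals `(3k² + 5k + 2)/2 − C(m+1,2)` and the remainder
`C(d+3,3) − c(d,m) − (d+1)·r(d,m)` equals `2·C(m+1,3)`. -/
theorem statement9 (m k : ℕ) (hm : 1 ≤ m) (hk : (m + 1).choose 3 ≤ k) :
    ((⌊((((3 * k + 3).choose 3 : ℚ))
          - (m : ℚ) * ((m : ℚ) + 1) * (3 * (3 * (k : ℚ)) + 5 - 2 * (m : ℚ)) / 6)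
        / (3 * (k : ℚ) + 1)⌋ : ℚ)
        = (3 * (k : ℚ) ^ 2 + 5 * (k : ℚ) + 2) / 2 - ((m + 1).choose 2 : ℚ))
    ∧ (((3 * k + 3).choose 3 : ℚ)
        - (m : ℚ) * ((m : ℚ) + 1) * (3 * (3 * (k : ℚ)) + 5 - 2 * (m : ℚ)) / 6
        - (3 * (k : ℚ) + 1)
            * (⌊((((3 * k + 3).choose 3 : ℚ))
                  - (m : ℚ) * ((m : ℚ) + 1) * (3 * (3 * (k : ℚ)) + 5 - 2 * (m : ℚ)) / 6)
                / (3 * (k : ℚ) + 1)⌋ : ℚ)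
        = 2 * ((m + 1).choose 3 : ℚ)) := by
  obtain ⟨q, hq⟩ := exists_nat_cast_eq_quadratic_div_two k
  have hk' : ((m + 1).choose 3 : ℚ) ≤ k := by exact_mod_cast hk
  have hpos : (0 : ℚ) < 3 * (k : ℚ) + 1 := by positivity
  have hnonneg : (0 : ℚ) ≤ ((m + 1).choose 3 : ℚ) := by positivity
  have hdiv : ((3 * k + 3).choose 3 : ℚ)
      - (m : ℚ) * ((m : ℚ) + 1) * (3 * (3 * (k : ℚ)) + 5 - 2 * (m : ℚ)) / 6
      = (3 * (k : ℚ) + 1) * ((q : ℚ) - ((m + 1).choose 2 : ℚ))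
        + 2 * ((m + 1).choose 3 : ℚ) := by
    rw [hq, Nat.cast_succ_choose_three (3 * k + 2), Nat.cast_succ_choose_three m,
      Nat.cast_choose_two]
    push_cast
    ring
  have hfloor : ⌊(((3 * k + 3).choose 3 : ℚ)
      - (m : ℚ) * ((m : ℚ) + 1) * (3 * (3 * (k : ℚ)) + 5 - 2 * (m : ℚ)) / 6)
        / (3 * (k : ℚ) + 1)⌋ = (q : ℤ) - ((m + 1).choose 2 : ℤ) := by
    rw [hdiv, Int.floor_eq_iff, le_div_iff₀ hpos, div_lt_iff₀ hpos]
    push_cast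
    constructor <;> linarith
  rw [hfloor, hdiv]
  push_cast
  exact ⟨by rw [hq], by ring⟩
end

section
/- Let m ≥ 1 and k be integers with k ≥ C(m+1,3), and set d = 3k+2. Then ⌊(C(d+3,3) − m(m+1)(3d+5−2m)/6)/(d+1)⌋ = (3k² + 9k + 6)/2 − C(m+1,2), and the corresponding remainder C(d+3,3) − m(m+1)(3d+5−2m)/6 − (d+1)·⌊(C(d+3,3) − m(m+1)(3d+5−2m)/6)/(d+1)⌋ equals k + 1 + 2·C(m+1,3). -/
theorem Nat.cast_succ_choose_three_rat (n : ℕ) :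
    ((n + 1).choose 3 : ℚ) = ((n : ℚ) + 1) * n * ((n : ℚ) - 1) / 6 := by
  induction n with
  | zero => simp [Nat.choose]
  | succ n ih =>
    rw [Nat.choose_succ_succ' (n + 1) 2, Nat.cast_add, ih, Nat.cast_choose_two]
    push_cast
    ring

/-- For integers `m ≥ 1` and `k ≥ C(m+1,3)`, with `d = 3k+2` and
`c(d,m) = m(m+1)(3d+5−2m)/6`, the quotient `r(d,m) = ⌊(C(d+3,3) − c(d,m))/(d+1)⌋`
equals `(3k² + 9k + 6)/2 − C(m+1,2)` and the remainder
`C(d+3,3) − c(d,m) − (d+1)·r(d,m)` equals `k + 1 + 2·C(m+1,3)`. -/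
theorem statement11 (m k : ℕ) (hm : 1 ≤ m) (hk : (m + 1).choose 3 ≤ k) :
    ((⌊((((3 * k + 2 + 3).choose 3 : ℚ))
          - (m : ℚ) * ((m : ℚ) + 1) * (3 * (3 * (k : ℚ) + 2) + 5 - 2 * (m : ℚ)) / 6)
        / (3 * (k : ℚ) + 2 + 1)⌋ : ℚ)
        = (3 * (k : ℚ) ^ 2 + 9 * (k : ℚ) + 6) / 2 - ((m + 1).choose 2 : ℚ))
    ∧ (((3 * k + 2 + 3).choose 3 : ℚ)
        - (m : ℚ) * ((m : ℚ) + 1) * (3 * (3 * (k : ℚ) + 2) + 5 - 2 * (m : ℚ)) / 6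
        - (3 * (k : ℚ) + 2 + 1)
            * (⌊((((3 * k + 2 + 3).choose 3 : ℚ))
                  - (m : ℚ) * ((m : ℚ) + 1) * (3 * (3 * (k : ℚ) + 2) + 5 - 2 * (m : ℚ)) / 6)
                / (3 * (k : ℚ) + 2 + 1)⌋ : ℚ)
        = (k : ℚ) + 1 + 2 * ((m + 1).choose 3 : ℚ)) := by
 
  obtain ⟨t, ht⟩ : ∃ t : ℕ, 3 * k ^ 2 + 9 * k = 2 * t := by
    obtain ⟨s, hs⟩ := Nat.even_mul_succ_self k
    exact ⟨3 * s + 3 * k, by linear_combination 3 * hs⟩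
  have htq : 3 * (k : ℚ) ^ 2 + 9 * k = 2 * t := by exact_mod_cast ht
  have hkq : ((m + 1).choose 3 : ℚ) ≤ k := by exact_mod_cast hk
  have hc_nonneg : (0 : ℚ) ≤ ((m + 1).choose 3 : ℚ) := Nat.cast_nonneg _
  have hk_nonneg : (0 : ℚ) ≤ k := Nat.cast_nonneg _
  have hc2 : ((m + 1).choose 2 : ℚ) = ((m : ℚ) + 1) * m / 2 := by
    rw [Nat.cast_choose_two]
    push_cast
    ring
  have hc3 := Nat.cast_succ_choose_three_rat m
  have hforms : ((3 * k + 2 + 3).choose 3 : ℚ)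
      = (3 * (k : ℚ) + 5) * (3 * k + 4) * (3 * k + 3) / 6 := by
    rw [Nat.cast_succ_choose_three_rat (3 * k + 4)]
    push_cast
    ring
  set N : ℚ := ((3 * k + 2 + 3).choose 3 : ℚ)
    - (m : ℚ) * ((m : ℚ) + 1) * (3 * (3 * (k : ℚ) + 2) + 5 - 2 * (m : ℚ)) / 6 with hN
  have hdiv : N = (3 * (k : ℚ) + 2 + 1)
      * ((3 * (k : ℚ) ^ 2 + 9 * (k : ℚ) + 6) / 2 - ((m + 1).choose 2 : ℚ))
      + (k + 1 + 2 * ((m + 1).choose 3 : ℚ)) := by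
    rw [hN, hforms, hc2, hc3]
    ring
  have hquot : (((t : ℤ) + 3 - ((m + 1).choose 2 : ℤ) : ℤ) : ℚ)
      = (3 * (k : ℚ) ^ 2 + 9 * (k : ℚ) + 6) / 2 - ((m + 1).choose 2 : ℚ) := by
    push_cast
    linarith
  have hfloor : ⌊N / (3 * (k : ℚ) + 2 + 1)⌋ = (t : ℤ) + 3 - ((m + 1).choose 2 : ℤ) := by
    rw [Int.floor_eq_iff, hquot, le_div_iff₀ (by positivity), div_lt_iff₀ (by positivity), hdiv]
    constructor <;> linarith
  rw [hfloor, hquot]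
  exact ⟨rfl, by rw [hdiv]; ring⟩
end
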